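/- Define g_4 : ℝ → ℝ by g_4(t) = 1 + 2·(U_1(t)/2) + 6.12·(U_2(t)/3) + 3.484·(U_3(t)/4) + 5.12·(U_4(t)/5) + 1.05·(U_9(t)/10), where U_k denotes the degree-k Chebyshev polynomial of the second kind, and define ĝ_4 : [-1,1] → ℝ by ĝ_4(t) = min(-(1/6.226)·g_4(t), 0) for t ≤ 1/2 and ĝ_4(t) = 2t - 1 for t > 1/2. Then for every N ≥ 0 and every sequence x_0, x_1, …, x_N of unit vectors in ℝ^4 with ⟨x_i, x_j⟩ ≤ 1/2 for all 0 ≤ i < j ≤ N, one has ∑_{i=0}^N ĝ_4(⟨x_0, x_i⟩) ≥ 0. -/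

import Mathlib

open scoped RealInnerProductSpace BigOperators

/-- The polynomial `g₄` of Musin, expressed via Gegenbauer polynomials
`G_k^{(4)}(t) = U_k(t)/(k+1)` (Chebyshev polynomials of the second kind). -/
noncomputable def gFour (t : ℝ) : ℝ :=
  1 + 2 * ((Polynomial.Chebyshev.U ℝ 1).eval t / 2)
    + 6.12 * ((Polynomial.Chebyshev.U ℝ 2).eval t / 3)
    + 3.484 * ((Polynomial.Chebyshev.U ℝ 3).eval t / 4)
    + 5.12 * ((Polynomial.Chebyshev.U ℝ 4).eval t / 5)
    + 1.05 * ((Polynomial.Chebyshev.U ℝ 9).eval t / 10)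

/-- The modified function `ĝ₄`. -/
noncomputable def gFourHat (t : ℝ) : ℝ :=
  if t ≤ 1 / 2 then min (-(1 / 6.226) * gFour t) 0 else 2 * t - 1

open Polynomial in
theorem gFour_neg (s : ℝ) :
    gFour (-s) = -(2 / 125) + 217 / 500 * s - 516 / 125 * s ^ 2 + 1229 / 125 * s ^ 3
      + 2048 / 125 * s ^ 4 - 1764 / 25 * s ^ 5 + 2688 / 25 * s ^ 7 - 1344 / 25 * s ^ 9 := by
  have h (k : ℕ) (t : ℝ) : (Chebyshev.U ℝ (k + 2 : ℤ)).eval t =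
      2 * t * (Chebyshev.U ℝ (k + 1 : ℤ)).eval t - (Chebyshev.U ℝ (k : ℤ)).eval t := by
    simp [Chebyshev.U_add_two]
  have h2 := h 0 (-s)
  have h3 := h 1 (-s)
  have h4 := h 2 (-s)
  have h5 := h 3 (-s)
  have h6 := h 4 (-s)
  have h7 := h 5 (-s)
  have h8 := h 6 (-s)
  have h9 := h 7 (-s)
  norm_num at h2 h3 h4 h5 h6 h7 h8 h9
  rw [gFour, h9, h8, h7, h6, h5, h4, h3, h2]
  simp
  ring

/-- The degree-`n` form `∑ₖ cₖ xᵏ yⁿ⁻ᵏ` whose list of coefficients is `c`. -/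
def bernsteinForm : List ℝ → ℝ → ℝ → ℝ
  | [], _, _ => 0
  | a :: c, x, y => a * y ^ c.length + x * bernsteinForm c x y

theorem bernsteinForm_nonneg {c : List ℝ} {x y : ℝ} (hc : ∀ a ∈ c, 0 ≤ a)
    (hx : 0 ≤ x) (hy : 0 ≤ y) : 0 ≤ bernsteinForm c x y := by
  induction c with
  | nil => exact le_rfl
  | cons a c ih =>
    have h := ih fun b hb => hc b (List.mem_cons_of_mem a hb)
    have ha := hc a List.mem_cons_self
    exact add_nonneg (by positivity) (by positivity)

theorem gFour_neg_nonpos {s : ℝ} (hl : -(1 / 2) ≤ s) (hu : s ≤ 3 / 5) :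
    gFour (-s) ≤ 0 := by
  rcases le_total s (2 / 25) with h0' | h0
  · have h := bernsteinForm_nonneg (c :=
      [0, 128723144531250, 689410400390625, 1399721289062500, 1325508289062500, 628625802343750,
       144531998640625, 13072668342500, 245527156225, 58485642156])
      (by norm_num) (sub_nonneg.2 hl) (sub_nonneg.2 h0')
    simp only [bernsteinForm, List.length] at h
    rw [gFour_neg]
    linear_combination (64 / 12506160324025) * h
  rcases le_total s (23 / 50) with h1' | h1
  · have h := bernsteinForm_nonneg (c :=
      [1696083622524, 20600781443117, 268237939407316, 994867536248573, 1434201890697614,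
       748843343548468, 40546451097044, 81774752765037, 120194787186186, 25567179658848])
      (by norm_num) (sub_nonneg.2 h0) (sub_nonneg.2 h1')
    simp only [bernsteinForm, List.length] at h
    rw [gFour_neg]
    linear_combination (64 / 8067192444475) * h
  have h := bernsteinForm_nonneg (c :=
    [25567179658848, 270597712098270, 1249878772631925, 3285756854185750, 5375389992805000,
     5611714709956250, 3668703935203125, 1394750297968750, 253389522265625, 10110675781250])
    (by norm_num) (sub_nonneg.2 h1) (sub_nonneg.2 hu)
  simp only [bernsteinForm, List.length] at h
  rw [gFour_neg]
  linear_combination (64 / 1008840175) * h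

/-! The upper bounds below are named by their slope, or leading coefficient, times `100`. -/

theorem gFour_neg_le_quadratic_1030 {s : ℝ} (hl : 3 / 5 ≤ s) (hu : s ≤ 1) :
    gFour (-s) ≤ 3 / 10 * (2 * s - 6 / 5) + 103 / 10 * (2 * s - 6 / 5) ^ 2 := by
  rcases le_total s (69 / 100) with h0' | h0
  · have h := bernsteinForm_nonneg (c :=
      [5176666000000000, 14233103100000000, 1076878260000000, 23303289531000000,
       259671338706600000, 642753536382090000, 764998385165544000, 496096522446542400,
       169412249707628940, 23949074515970809])
      (by norm_num) (sub_nonneg.2 hl) (sub_nonneg.2 h0')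
    simp only [bernsteinForm, List.length] at h
    rw [gFour_neg]
    linear_combination (64 / 9685512225) * h
  rcases le_total s (89 / 100) with h1' | h1
  · have h := bernsteinForm_nonneg (c :=
      [23949074515970809, 318051494946200261, 1696888276305566564, 4719549522785978596,
       7507343806186506414, 6954917185547186534, 3569397235058090836, 854331962944778164,
       51705273074268321, 2444250916259389])
      (by norm_num) (sub_nonneg.2 h0) (sub_nonneg.2 h1')
    simp only [bernsteinForm, List.length] at h
    rw [gFour_neg]
    linear_combination (1 / 200000000000) * h
  have h := bernsteinForm_nonneg (c :=
    [2444250916259389, 5659400090970900, 117208718171560000, 1061723413045000000,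
     3999530418031250000, 8101853032875000000, 9657619909375000000, 6822215937500000000,
     2654492187500000000, 439843750000000000])
    (by norm_num) (sub_nonneg.2 h1) (sub_nonneg.2 hu)
  simp only [bernsteinForm, List.length] at h
  rw [gFour_neg]
  linear_combination (64 / 58948692275) * h

theorem gFour_neg_le_quadratic_1160 {s : ℝ} (hl : 3 / 5 ≤ s) (hu : s ≤ 1) :
    gFour (-s) ≤ -(9 / 10) * (2 * s - 6 / 5) + 58 / 5 * (2 * s - 6 / 5) ^ 2
      + 7 / 50 * (4 * s ^ 2 - 1) := by
  rcases le_total s (69 / 100) with h0' | h0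
  · have h := bernsteinForm_nonneg (c :=
      [29239166000000000, 170045603100000000, 399551878260000000, 471128289531000000,
       272271338706600000, 60003536382090000, 22123385165544000, 44071522446542400,
       27549749707628940, 5486574515970809])
      (by norm_num) (sub_nonneg.2 hl) (sub_nonneg.2 h0')
    simp only [bernsteinForm, List.length] at h
    rw [gFour_neg]
    linear_combination (64 / 9685512225) * h
  rcases le_total s (23 / 25) with h1' | h1
  · have h := bernsteinForm_nonneg (c :=
      [5486574515970809, 105165468591569708, 782197432746291776, 2588667143245552192,
       4358733671870874384, 3803795916125352512, 1508428384887473344, 149693893639744768,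
       45204599661248256, 52766066285530112])
      (by norm_num) (sub_nonneg.2 h0) (sub_nonneg.2 h1')
    simp only [bernsteinForm, List.length] at h
    rw [gFour_neg]
    linear_combination (64 / 45028816536575) * h
  have h := bernsteinForm_nonneg (c :=
    [51529361606963, 609718737108225, 3222082704467500, 9922125140312500, 19549349597656250,
     25503918667968750, 22007852148437500, 12108344726562500, 3854217529296875, 540924072265625])
    (by norm_num) (sub_nonneg.2 h1) (sub_nonneg.2 hu)
  simp only [bernsteinForm, List.length] at h
  rw [gFour_neg]
  linear_combination (1 / 51200) * h

theorem gFour_neg_le_quadratic_1280 {s : ℝ} (hl : 3 / 5 ≤ s) (hu : s ≤ 1) :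
    gFour (-s) ≤ -(14 / 5) * (2 * s - 6 / 5) + 64 / 5 * (2 * s - 6 / 5) ^ 2
      + 12 / 25 * (4 * s ^ 2 - 1) := by
  rcases le_total s (81 / 100) with h0' | h0
  · have h := bernsteinForm_nonneg (c :=
      [12525238000000000, 56285261700000000, 85930590180000000, 40356134217000000,
       1531798123800000, 51189456003630000, 91353649265592000, 56956011850276800,
       15188807973462420, 1745602612087363])
      (by norm_num) (sub_nonneg.2 hl) (sub_nonneg.2 h0')
    simp only [bernsteinForm, List.length] at h
    rw [gFour_neg]
    linear_combination (64 / 2836714452075) * h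
  have h := bernsteinForm_nonneg (c :=
    [12219218284611541, 113276529618554900, 456506004056040000, 1198915565445000000,
     2732119999781250000, 5410410587875000000, 7671015059375000000, 6746881562500000000,
     3256210937500000000, 658593750000000000])
    (by norm_num) (sub_nonneg.2 h0) (sub_nonneg.2 hu)
  simp only [bernsteinForm, List.length] at h
  rw [gFour_neg]
  linear_combination (64 / 8067192444475) * h

theorem gFour_neg_le_linear_620 {s : ℝ} (hl : 3 / 5 ≤ s) (hu : s ≤ 887 / 1000) :
    gFour (-s) ≤ 31 / 5 * (2 * s - 6 / 5) := by
  have h := bernsteinForm_nonneg (c :=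
    [5176666000000000000000000, 1266298089130000000000000000, 9366553519165400000000000000,
     29878043351362577000000000000, 52590352943249776060000000000, 54725012733213585868700000000,
     33320221506213044342016000000, 10808019685777358866799280000, 1395061235239559289739601400,
     269442264566063649035267])
    (by norm_num) (sub_nonneg.2 hl) (sub_nonneg.2 hu)
  simp only [bernsteinForm, List.length] at h
  rw [gFour_neg]
  linear_combination (64 / 330276047985842134183175) * h

theorem gFour_neg_le_linear_520 {s : ℝ} (hl : 3 / 5 ≤ s) (hu : s ≤ 211 / 250) :
    gFour (-s) ≤ 26 / 5 * (2 * s - 6 / 5) := by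
  have h := bernsteinForm_nonneg (c :=
    [19747413635253906250, 3406255216827392578125, 24946903091345214843750,
     79349998703107666015625, 139997414787976425781250, 147103749916981178125000,
     91555450567129618968750, 31033953626298877975625, 4378901772706303211350,
     4705746645651533936])
    (by norm_num) (sub_nonneg.2 hl) (sub_nonneg.2 hu)
  simp only [bernsteinForm, List.length] at h
  rw [gFour_neg]
  linear_combination (64 / 292353652320853525) * h

theorem gFour_neg_le_linear_422 {s : ℝ} (hl : 3 / 5 ≤ s) (hu : s ≤ 201 / 250) :
    gFour (-s) ≤ 211 / 50 * (2 * s - 6 / 5) := by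
  have h := bernsteinForm_nonneg (c :=
    [19747413635253906250, 2281180221405029296875, 16425555899450683593750,
     51851795912221435546875, 91197619260535605468750, 95982555344416021875000,
     60239059920454877718750, 20808545449496585806875, 3046932959539946825850,
     4887543545929887196])
    (by norm_num) (sub_nonneg.2 hl) (sub_nonneg.2 hu)
  simp only [bernsteinForm, List.length] at h
  rw [gFour_neg]
  linear_combination (64 / 58354129327261275) * h

theorem gFour_neg_le_linear_328 {s : ℝ} (hl : 3 / 5 ≤ s) (hu : s ≤ 191 / 250) :
    gFour (-s) ≤ 82 / 25 * (2 * s - 6 / 5) := by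
  have h := bernsteinForm_nonneg (c :=
    [19747413635253906250, 1409305756988525390625, 9844232103552246093750,
     30633569492282470703125, 53407584118399472656250, 55943242568025475000000,
     35097922226208605218750, 12188631480248007513125, 1807283896625001200350,
     2027335896722741656])
    (by norm_num) (sub_nonneg.2 hl) (sub_nonneg.2 hu)
  simp only [bernsteinForm, List.length] at h
  rw [gFour_neg]
  linear_combination (64 / 8184548359849025) * h

theorem gFour_neg_le_linear_220 {s : ℝ} (hl : 3 / 5 ≤ s) (hu : s ≤ 71 / 100) :
    gFour (-s) ≤ 11 / 5 * (2 * s - 6 / 5) := by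
  have h := bernsteinForm_nonneg (c :=
    [470606000000000, 15483993900000000, 99218273460000000, 297096429659000000,
     506329905016600000, 523336979036810000, 326943597361064000, 114639330028129600,
     17833640955826340, 239294671087241])
    (by norm_num) (sub_nonneg.2 hl) (sub_nonneg.2 hu)
  simp only [bernsteinForm, List.length] at h
  rw [gFour_neg]
  linear_combination (64 / 5358972025) * h

theorem gFour_neg_le_chord_520 {s : ℝ} (hl : 887 / 1000 ≤ s) (hu : s ≤ 917 / 1000) :
    gFour (-s) ≤ 3113 / 500 - 26 / 5 * (11 / 5 - 2 * s) := by
  have h := bernsteinForm_nonneg (c :=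
    [176831942264566063649035267, 1422478246423763766196897473, 5010130790761538956861623372,
     10099173221662134012274648788, 12760689455446782027236436762, 10377797712580329329920690542,
     5338082409264903800629848348, 1616062821589534793236268772, 238084274232802872733962363,
     8306869715245162482400537])
    (by norm_num) (sub_nonneg.2 hl) (sub_nonneg.2 hu)
  simp only [bernsteinForm, List.length] at h
  rw [gFour_neg]
  linear_combination (1 / 7688671875000) * h

theorem gFour_neg_le_chord_422 {s : ℝ} (hl : 917 / 1000 ≤ s) (hu : s ≤ 941 / 1000) :
    gFour (-s) ≤ 3113 / 500 - 211 / 50 * (11 / 5 - 2 * s) := by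
  have h := bernsteinForm_nonneg (c :=
    [148416244715245162482400537, 1186713245000729334027718809, 4157400150241608925723164228,
     8343751404096498693372970836, 10512833110286752307459014542, 8547428644232836359621745566,
     4416383669917305495593572212, 1357056293300176447172055204, 209177732821455681736909473,
     9261321352182216758915281])
    (by norm_num) (sub_nonneg.2 hl) (sub_nonneg.2 hu)
  simp only [bernsteinForm, List.length] at h
  rw [gFour_neg]
  linear_combination (1 / 1031956070400) * h

theorem gFour_neg_le_chord_328 {s : ℝ} (hl : 941 / 1000 ≤ s) (hu : s ≤ 193 / 200) :
    gFour (-s) ≤ 3113 / 500 - 82 / 25 * (11 / 5 - 2 * s) := by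
  have h := bernsteinForm_nonneg (c :=
    [126026946352182216758915281, 990791676517824219923565585, 3406405342871124752665304100,
     6692918808948578072272408500, 8228221534427195542789278750, 6495500943021021187927368750,
     3232048225728881363336812500, 940887558454563334941562500, 131292888256715375722265625,
     3895950694167914166015625])
    (by norm_num) (sub_nonneg.2 hl) (sub_nonneg.2 hu)
  simp only [bernsteinForm, List.length] at h
  rw [gFour_neg]
  linear_combination (1 / 1031956070400) * h

theorem gFour_neg_le_chord_220 {s : ℝ} (hl : 193 / 200 ≤ s) (hu : s ≤ 1) :
    gFour (-s) ≤ 3113 / 500 - 11 / 5 * (11 / 5 - 2 * s) := by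
  have h := bernsteinForm_nonneg (c :=
    [60314726755413972053, 455861306231853317800, 1509096624263331920000, 2874291838210240000000,
     3484083067594500000000, 2813824106772000000000, 1543717992600000000000,
     572905160000000000000, 135670000000000000000, 16000000000000000000])
    (by norm_num) (sub_nonneg.2 hl) (sub_nonneg.2 hu)
  simp only [bernsteinForm, List.length] at h
  rw [gFour_neg]
  linear_combination (64 / 1008840175) * h

theorem norm_sq_sum_smul {E ι : Type*} [NormedAddCommGroup E] [InnerProductSpace ℝ E]
    (I : Finset ι) (ψ : ι → ℝ) (y : ι → E) :
    ‖∑ i ∈ I, ψ i • y i‖ ^ 2 = ∑ i ∈ I, ∑ j ∈ I, ψ i * ψ j * ⟪y i, y j⟫ := by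
  rw [← real_inner_self_eq_norm_sq, sum_inner]
  refine Finset.sum_congr rfl fun i _ => ?_
  rw [inner_sum]
  refine Finset.sum_congr rfl fun j _ => ?_
  rw [real_inner_smul_left, real_inner_smul_right, mul_assoc]

/-- Nonnegative combinations of unit vectors with pairwise inner products at most `1 / 2`. -/
theorem norm_sq_sum_smul_le {E ι : Type*} [NormedAddCommGroup E] [InnerProductSpace ℝ E]
    (I : Finset ι) {y : ι → E} (hy : ∀ i ∈ I, ‖y i‖ = 1)
    (hsep : ∀ i ∈ I, ∀ j ∈ I, i ≠ j → ⟪y i, y j⟫ ≤ 1 / 2) {ψ : ι → ℝ} (hψ : ∀ i ∈ I, 0 ≤ ψ i) :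
    ‖∑ i ∈ I, ψ i • y i‖ ^ 2 ≤ (∑ i ∈ I, ψ i ^ 2) / 2 + (∑ i ∈ I, ψ i) ^ 2 / 2 := by
  classical
  have key : ∀ i ∈ I, ∀ j ∈ I, ψ i * ψ j * ⟪y i, y j⟫ ≤
      (if i = j then ψ i ^ 2 / 2 else 0) + ψ i * ψ j / 2 := by
    intro i hi j hj
    by_cases h : i = j
    · subst h
      rw [real_inner_self_eq_norm_sq, hy i hi, if_pos rfl]
      linarith
    · have := mul_le_mul_of_nonneg_left (hsep i hi j hj h) (mul_nonneg (hψ i hi) (hψ j hj))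
      rw [if_neg h]
      linarith
  rw [norm_sq_sum_smul]
  calc ∑ i ∈ I, ∑ j ∈ I, ψ i * ψ j * ⟪y i, y j⟫
      ≤ ∑ i ∈ I, ∑ j ∈ I, ((if i = j then ψ i ^ 2 / 2 else 0) + ψ i * ψ j / 2) :=
        Finset.sum_le_sum fun i hi => Finset.sum_le_sum fun j hj => key i hi j hj
    _ = _ := by
        rw [sq (∑ i ∈ I, ψ i), Finset.sum_mul_sum]
        simp only [Finset.sum_add_distrib, Finset.sum_ite_eq, Finset.sum_div]
        congr 1
        exact Finset.sum_congr rfl fun i hi => by rw [if_pos hi]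

theorem sq_sum_mul_inner_le {E ι : Type*} [NormedAddCommGroup E] [InnerProductSpace ℝ E]
    (I : Finset ι) {y : ι → E} {f : E} (hf : ‖f‖ = 1) (hy : ∀ i ∈ I, ‖y i‖ = 1)
    (hsep : ∀ i ∈ I, ∀ j ∈ I, i ≠ j → ⟪y i, y j⟫ ≤ 1 / 2) {ψ : ι → ℝ} (hψ : ∀ i ∈ I, 0 ≤ ψ i) :
    (∑ i ∈ I, ψ i * ⟪y i, f⟫) ^ 2 ≤ (∑ i ∈ I, ψ i ^ 2) / 2 + (∑ i ∈ I, ψ i) ^ 2 / 2 := by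
  refine le_trans ?_ (norm_sq_sum_smul_le I hy hsep hψ)
  have h : ∑ i ∈ I, ψ i * ⟪y i, f⟫ = ⟪∑ i ∈ I, ψ i • y i, f⟫ := by
    simp only [sum_inner, real_inner_smul_left]
  rw [h, sq_le_sq, abs_norm]
  simpa [hf] using abs_real_inner_le_norm (∑ i ∈ I, ψ i • y i) f

/-- Two such vectors cannot both be close to the unit vector `f`. -/
theorem inner_sq_add_inner_sq_le {E : Type*} [NormedAddCommGroup E] [InnerProductSpace ℝ E]
    {u v f : E} (hf : ‖f‖ = 1) (hu : ‖u‖ = 1) (hv : ‖v‖ = 1) (huv : ⟪u, v⟫ ≤ 1 / 2)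
    (h1 : ⟪v, f⟫ ≤ 2 * ⟪u, f⟫) (h2 : ⟪u, f⟫ ≤ 2 * ⟪v, f⟫) :
    ⟪u, f⟫ ^ 2 + ⟪v, f⟫ ^ 2 - ⟪u, f⟫ * ⟪v, f⟫ ≤ 3 / 4 := by
  have h := sq_sum_mul_inner_le (Finset.univ : Finset Bool) (y := fun b => cond b u v)
    (ψ := fun b => cond b (2 * ⟪u, f⟫ - ⟪v, f⟫) (2 * ⟪v, f⟫ - ⟪u, f⟫)) hf
    (by simp [hu, hv]) (by simpa [real_inner_comm v u] using huv) (by simp [h1, h2])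
  simp only [Fintype.sum_bool, cond_true, cond_false] at h
  set a := ⟪u, f⟫
  set b := ⟪v, f⟫
  by_contra! hK
  nlinarith

theorem sq_sum_mul_norm_sq_le {E ι : Type*} [NormedAddCommGroup E] [InnerProductSpace ℝ E]
    [FiniteDimensional ℝ E] (I : Finset ι) (b : ι → ℝ) (w : ι → E) :
    (∑ i ∈ I, b i * ‖w i‖ ^ 2) ^ 2 ≤
      Module.finrank ℝ E * ∑ i ∈ I, ∑ j ∈ I, b i * b j * ⟪w i, w j⟫ ^ 2 := by
  let e := stdOrthonormalBasis ℝ E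
  let M := fun k l => ∑ i ∈ I, b i * (⟪w i, e k⟫ * ⟪w i, e l⟫)
  have htr : ∑ i ∈ I, b i * ‖w i‖ ^ 2 = ∑ k, M k k := by
    rw [Finset.sum_comm]
    refine Finset.sum_congr rfl fun i _ => ?_
    rw [← Finset.mul_sum, ← real_inner_self_eq_norm_sq, ← e.sum_inner_mul_inner]
    simp only [real_inner_comm]
  have hsq : ∑ i ∈ I, ∑ j ∈ I, b i * b j * ⟪w i, w j⟫ ^ 2 = ∑ k, ∑ l, M k l ^ 2 := by
    have hM (k l) : M k l ^ 2 = ∑ i ∈ I, ∑ j ∈ I,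
        b i * b j * ((⟪w i, e k⟫ * ⟪w j, e k⟫) * (⟪w i, e l⟫ * ⟪w j, e l⟫)) := by
      rw [sq, Finset.sum_mul_sum]
      exact Finset.sum_congr rfl fun i _ => Finset.sum_congr rfl fun j _ => by ring
    have hw (i j) : ⟪w i, w j⟫ = ∑ k, ⟪w i, e k⟫ * ⟪w j, e k⟫ := by
      rw [← e.sum_inner_mul_inner]
      exact Finset.sum_congr rfl fun k _ => by rw [real_inner_comm (w j)]
    calc ∑ i ∈ I, ∑ j ∈ I, b i * b j * ⟪w i, w j⟫ ^ 2
        = ∑ i ∈ I, ∑ k, ∑ j ∈ I, ∑ l,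
          b i * b j * ((⟪w i, e k⟫ * ⟪w j, e k⟫) * (⟪w i, e l⟫ * ⟪w j, e l⟫)) := by
          refine Finset.sum_congr rfl fun i _ => ?_
          rw [Finset.sum_comm]
          refine Finset.sum_congr rfl fun j _ => ?_
          rw [hw, sq, Finset.sum_mul_sum, Finset.mul_sum]
          simp only [Finset.mul_sum]
      _ = ∑ k, ∑ l, M k l ^ 2 := by
          rw [Finset.sum_comm]
          refine Finset.sum_congr rfl fun k _ => ?_
          simp only [hM]
          exact (Finset.sum_congr rfl fun i _ => Finset.sum_comm).trans Finset.sum_comm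
  rw [htr, hsq]
  calc (∑ k, M k k) ^ 2 ≤ Module.finrank ℝ E * ∑ k, M k k ^ 2 := by
        simpa using sq_sum_le_card_mul_sum_sq (s := Finset.univ) (f := fun k => M k k)
    _ ≤ _ := by
        gcongr with k
        exact Finset.single_le_sum (f := fun l => M k l ^ 2) (fun l _ => sq_nonneg _)
          (Finset.mem_univ k)

theorem sq_add_half_le {u v t X Y : ℝ} (hu : 1 / 2 < u) (hu1 : u < 1) (hv : 1 / 2 < v)
    (hv1 : v < 1) (hX : 0 ≤ X) (hX2 : X ^ 2 = (1 - u ^ 2) * (1 - v ^ 2))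
    (hY2 : Y ^ 2 = (4 * u ^ 2 - 1) * (4 * v ^ 2 - 1)) (ht : -X ≤ t) (ht' : t ≤ 1 / 2 - u * v) :
    t ^ 2 + t / 2 ≤ X ^ 2 / 3 - X * Y / 6 := by
  have hXY : 4 * X + Y ≤ 3 := by
    have h : 8 * (X * Y) ≤
        4 * (1 - u ^ 2) * (4 * v ^ 2 - 1) + (4 * u ^ 2 - 1) * (4 * (1 - v ^ 2)) := by
      refine (abs_le_of_sq_le_sq' ?_ ?_).2
      · rw [mul_pow, mul_pow, hX2, hY2]
        nlinarith [sq_nonneg (u ^ 2 - v ^ 2)]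
      · have hu2 : 0 ≤ 1 - u ^ 2 := by nlinarith
        have hv2 : 0 ≤ 1 - v ^ 2 := by nlinarith
        have hu2' : 0 ≤ 4 * u ^ 2 - 1 := by nlinarith
        have hv2' : 0 ≤ 4 * v ^ 2 - 1 := by nlinarith
        positivity
    exact (abs_le_of_sq_le_sq' (by linarith) (by norm_num)).2
  have hleft : X ^ 2 - X / 2 ≤ X ^ 2 / 3 - X * Y / 6 := by nlinarith
  have hright : (1 / 2 - u * v) ^ 2 + (1 / 2 - u * v) / 2 ≤ X ^ 2 / 3 - X * Y / 6 := by
    have h1 : 0 < 1 - u * v := by nlinarith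
    have h2 : 0 < 4 * (u * v) - 1 := by nlinarith
    have h3 : 0 ≤ 2 * ((1 - u * v) * (4 * (u * v) - 1)) *
        (2 * X ^ 2 - 3 * (1 - 2 * (u * v)) * (1 - u * v) - X * Y) := by
      have h4 := sq_nonneg ((4 * (u * v) - 1) * X - (1 - u * v) * Y)
      have h5 : 0 ≤ (6 * (u * v) - 3) ^ 2 * (u - v) ^ 2 := by positivity
      linear_combination h4 + h5 - (4 * (u * v) - 1) * (5 - 8 * (u * v)) * hX2 +
        (1 - u * v) ^ 2 * hY2
    have h4 := nonneg_of_mul_nonneg_right h3 (by positivity)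
    linarith
  rcases le_total 0 (t + (1 / 2 - u * v) + 1 / 2) with h | h
  · linarith [mul_nonneg h (sub_nonneg.2 ht')]
  · have hX1 : X ≤ 1 - u * v :=
      (abs_le_of_sq_le_sq' (by nlinarith [sq_nonneg (u - v)]) (by nlinarith)).2
    have htX : t = -X := by linarith
    rw [htX]
    linarith

/-- A bound for the points of a spherical `π / 3`-code in `ℝ⁴` that lie within angle `π / 3` of a
unit vector `f`. -/
theorem sum_four_mul_inner_sq_sub_one_le {E ι : Type*} [NormedAddCommGroup E]
    [InnerProductSpace ℝ E] (hE : Module.finrank ℝ E = 4) (I : Finset ι) {y : ι → E} {f : E}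
    (hf : ‖f‖ = 1) (hy : ∀ i ∈ I, ‖y i‖ = 1)
    (hsep : ∀ i ∈ I, ∀ j ∈ I, i ≠ j → ⟪y i, y j⟫ ≤ 1 / 2) (hs : ∀ i ∈ I, 1 / 2 < ⟪y i, f⟫) :
    ∑ i ∈ I, (4 * ⟪y i, f⟫ ^ 2 - 1) ≤ 6 := by
  classical
  have hs1 : ∀ i ∈ I, ⟪y i, f⟫ ≤ 1 := fun i hi => by
    simpa [hf, hy i hi] using real_inner_le_norm (y i) f
  by_cases hone : ∃ i ∈ I, ⟪y i, f⟫ = 1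
  · obtain ⟨i, hi, hi1⟩ := hone
    have hI : I = {i} := by
      refine Finset.eq_singleton_iff_unique_mem.2 ⟨hi, fun j hj => ?_⟩
      by_contra hji
      have h := inner_sq_add_inner_sq_le hf (hy j hj) (hy i hi) (hsep j hj i hi hji)
        (by linarith [hs j hj]) (by linarith [hs1 j hj])
      rw [hi1] at h
      nlinarith [hs j hj]
    rw [hI, Finset.sum_singleton, hi1]
    norm_num
  push Not at hone
  have hlt : ∀ i ∈ I, ⟪y i, f⟫ < 1 := fun i hi => lt_of_le_of_ne (hs1 i hi) (hone i hi)
  set s : ι → ℝ := fun i => ⟪y i, f⟫ with hsdef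
  set q : ι → ℝ := fun i => √(1 - s i ^ 2)
  set r : ι → ℝ := fun i => √(4 * s i ^ 2 - 1)
  have hq : ∀ i ∈ I, 0 < q i := fun i hi => Real.sqrt_pos.2 (by nlinarith [hs i hi, hlt i hi])
  have hr : ∀ i ∈ I, 0 < r i := fun i hi => Real.sqrt_pos.2 (by nlinarith [hs i hi, hlt i hi])
  have hq2 : ∀ i ∈ I, q i ^ 2 = 1 - s i ^ 2 := fun i hi =>
    Real.sq_sqrt (by nlinarith [hs i hi, hlt i hi])
  have hr2 : ∀ i ∈ I, r i ^ 2 = 4 * s i ^ 2 - 1 := fun i hi =>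
    Real.sq_sqrt (by nlinarith [hs i hi, hlt i hi])
  have : FiniteDimensional ℝ E := .of_finrank_pos (by omega)
  have hmem (i : ι) : y i - s i • f ∈ (ℝ ∙ f)ᗮ := by
    rw [Submodule.mem_orthogonal_singleton_iff_inner_left, inner_sub_left, real_inner_smul_left,
      real_inner_self_eq_norm_sq, hf]
    simp [hsdef]
  let w : ι → (ℝ ∙ f)ᗮ := fun i => ⟨y i - s i • f, hmem i⟩
  have hw (i j : ι) : ⟪w i, w j⟫ = ⟪y i, y j⟫ - s i * s j := by
    rw [Submodule.coe_inner, inner_sub_left, inner_sub_right, inner_sub_right]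
    simp only [real_inner_smul_left, real_inner_smul_right, real_inner_self_eq_norm_sq, hf,
      hsdef]
    rw [real_inner_comm (y j) f]
    ring
  have hwn : ∀ i ∈ I, ‖w i‖ = q i := fun i hi => by
    rw [eq_comm, Real.sqrt_eq_iff_eq_sq (by nlinarith [hs i hi, hlt i hi]) (norm_nonneg _),
      ← real_inner_self_eq_norm_sq, hw, real_inner_self_eq_norm_sq, hy i hi]
    ring
  have hrank : Module.finrank ℝ (ℝ ∙ f)ᗮ = 3 := by
    have := Fact.mk (hE : Module.finrank ℝ E = 3 + 1)
    exact Submodule.finrank_orthogonal_span_singleton (by rintro rfl; simp at hf)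
  have htensor := sq_sum_mul_norm_sq_le I (fun i => r i / q i) w
  have hgram : 0 ≤ ∑ i ∈ I, ∑ j ∈ I, r i / q i * (r j / q j) * ⟪w i, w j⟫ := by
    rw [← norm_sq_sum_smul I (fun i => r i / q i) w]
    positivity
  have htrace : ∑ i ∈ I, r i / q i * ‖w i‖ ^ 2 = ∑ i ∈ I, r i * q i :=
    Finset.sum_congr rfl fun i hi => by
      have := (hq i hi).ne'
      rw [hwn i hi]
      field_simp
  have hterm : ∀ i ∈ I, ∀ j ∈ I,
      r i / q i * (r j / q j) * ⟪w i, w j⟫ ^ 2 + r i / q i * (r j / q j) * ⟪w i, w j⟫ / 2 ≤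
        (r i * q i) * (r j * q j) / 3 - r i ^ 2 * r j ^ 2 / 6 + if i = j then r i ^ 2 else 0 := by
    intro i hi j hj
    have hqi := hq i hi
    have hqj := hq j hj
    have hri := hr i hi
    have hrj := hr j hj
    by_cases hij : i = j
    · subst hij
      rw [if_pos rfl, real_inner_self_eq_norm_sq, hwn i hi]
      have h : r i ^ 2 = 3 - 4 * q i ^ 2 := by rw [hr2 i hi, hq2 i hi]; ring
      refine le_of_eq ?_
      field_simp
      linear_combination 6 * h
    · rw [if_neg hij]
      have h := sq_add_half_le (t := ⟪w i, w j⟫) (Y := r i * r j) (hs i hi) (hlt i hi) (hs j hj)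
        (hlt j hj) (mul_pos hqi hqj).le (by rw [mul_pow, hq2 i hi, hq2 j hj])
        (by rw [mul_pow, hr2 i hi, hr2 j hj])
        (by
          rw [← hwn i hi, ← hwn j hj]
          exact neg_le_of_abs_le (abs_real_inner_le_norm _ _))
        (by rw [hw]; linarith [hsep i hi j hj hij])
      have h' := mul_le_mul_of_nonneg_left h
        (by positivity : 0 ≤ r i / q i * (r j / q j))
      refine le_trans (le_of_eq (by ring)) (h'.trans (le_of_eq ?_))
      field_simp
      ring
  have hsum := Finset.sum_le_sum fun i hi => Finset.sum_le_sum (hterm i hi)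
  simp only [Finset.sum_add_distrib, Finset.sum_sub_distrib, ← Finset.sum_div, Finset.sum_ite_eq,
    ← Finset.sum_mul_sum] at hsum
  have hdiag : ∑ i ∈ I, (if i ∈ I then r i ^ 2 else 0) = ∑ i ∈ I, r i ^ 2 :=
    Finset.sum_congr rfl fun i hi => if_pos hi
  have hgoal : ∑ i ∈ I, (4 * s i ^ 2 - 1) = ∑ i ∈ I, r i ^ 2 :=
    Finset.sum_congr rfl fun i hi => (hr2 i hi).symm
  rw [hrank, htrace] at htensor
  push_cast at htensor
  rw [hdiag] at hsum
  rw [hgoal]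
  by_contra! h
  nlinarith

/-- If `P = ∑ c i` and `Q = ∑ c i ^ 2` for `c i = 2 * s i - 6 / 5`, the constraint `h` bounds
some positive combination of `P` and `Q`, depending on the size of `P ≥ 1`. -/
theorem quadratic_bound_cases {P Q : ℝ} (hP : 1 ≤ P)
    (h : (Q + 6 / 5 * P) ^ 2 ≤ 2 * Q + 2 * P ^ 2) :
    3 / 10 * P + 103 / 10 * Q ≤ 3113 / 500 ∨
      -(9 / 10) * P + 58 / 5 * Q + 7 / 50 * 6 ≤ 3113 / 500 ∨
      -(14 / 5) * P + 64 / 5 * Q + 12 / 25 * 6 ≤ 3113 / 500 := by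
  rcases le_total P (13 / 10) with h1 | h1
  · left
    by_contra! hQ
    have := mul_nonneg (sub_nonneg.2 hP) (sub_nonneg.2 h1)
    nlinarith
  rcases le_total P (3 / 2) with h2 | h2
  · right; left
    by_contra! hQ
    have := mul_nonneg (sub_nonneg.2 h1) (sub_nonneg.2 h2)
    nlinarith
  · right; right
    by_contra! hQ
    nlinarith

theorem sum_gFour_neg_le {E ι : Type*} [NormedAddCommGroup E] [InnerProductSpace ℝ E]
    (hE : Module.finrank ℝ E = 4) (I : Finset ι) {y : ι → E} {f : E} (hf : ‖f‖ = 1)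
    (hy : ∀ i ∈ I, ‖y i‖ = 1) (hsep : ∀ i ∈ I, ∀ j ∈ I, i ≠ j → ⟪y i, y j⟫ ≤ 1 / 2)
    (hs : ∀ i ∈ I, 3 / 5 ≤ ⟪y i, f⟫) :
    ∑ i ∈ I, gFour (-⟪y i, f⟫) ≤ 3113 / 500 := by
  classical
  have hs1 : ∀ i ∈ I, ⟪y i, f⟫ ≤ 1 := fun i hi => by
    simpa [hf, hy i hi] using real_inner_le_norm (y i) f
  have hD := sum_four_mul_inner_sq_sub_one_le hE I hf hy hsep fun i hi => by linarith [hs i hi]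
  have hPQ := sq_sum_mul_inner_le I hf hy hsep (ψ := fun i => 2 * ⟪y i, f⟫ - 6 / 5)
    fun i hi => by linarith [hs i hi]
  have hpair : ∀ i ∈ I, ∀ j ∈ I, j ≠ i →
      ⟪y j, f⟫ ^ 2 + ⟪y i, f⟫ ^ 2 - ⟪y j, f⟫ * ⟪y i, f⟫ ≤ 3 / 4 := fun i hi j hj hij =>
    inner_sq_add_inner_sq_le hf (hy j hj) (hy i hi) (hsep j hj i hi hij)
      (by linarith [hs j hj, hs1 i hi]) (by linarith [hs i hi, hs1 j hj])
  set s : ι → ℝ := fun i => ⟪y i, f⟫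
  change ∀ i ∈ I, 3 / 5 ≤ s i at hs
  change ∀ i ∈ I, s i ≤ 1 at hs1
  change ∑ i ∈ I, (4 * s i ^ 2 - 1) ≤ 6 at hD
  change ∀ i ∈ I, ∀ j ∈ I, j ≠ i → s j ^ 2 + s i ^ 2 - s j * s i ≤ 3 / 4 at hpair
  change ∑ i ∈ I, gFour (-s i) ≤ 3113 / 500
  change (∑ i ∈ I, (2 * s i - 6 / 5) * s i) ^ 2 ≤ _ at hPQ
  have hcs : ∑ i ∈ I, (2 * s i - 6 / 5) * s i =
      (∑ i ∈ I, (2 * s i - 6 / 5) ^ 2 + 6 / 5 * ∑ i ∈ I, (2 * s i - 6 / 5)) / 2 := by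
    rw [Finset.mul_sum, ← Finset.sum_add_distrib, Finset.sum_div]
    exact Finset.sum_congr rfl fun i _ => by ring
  rw [hcs] at hPQ
  change _ ≤ (∑ i ∈ I, (2 * s i - 6 / 5) ^ 2) / 2 + (∑ i ∈ I, (2 * s i - 6 / 5)) ^ 2 / 2 at hPQ
  set P := ∑ i ∈ I, (2 * s i - 6 / 5) with hPdef
  set Q := ∑ i ∈ I, (2 * s i - 6 / 5) ^ 2
  rcases le_or_gt 1 P with hP | hP
  · rcases quadratic_bound_cases (Q := Q) hP (by linarith) with h | h | h
    · refine (Finset.sum_le_sum fun i hi =>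
        gFour_neg_le_quadratic_1030 (hs i hi) (hs1 i hi)).trans ?_
      rwa [Finset.sum_add_distrib, ← Finset.mul_sum, ← Finset.mul_sum]
    · refine (Finset.sum_le_sum fun i hi =>
        gFour_neg_le_quadratic_1160 (hs i hi) (hs1 i hi)).trans ?_
      rw [Finset.sum_add_distrib, Finset.sum_add_distrib, ← Finset.mul_sum, ← Finset.mul_sum,
        ← Finset.mul_sum]
      linarith
    · refine (Finset.sum_le_sum fun i hi =>
        gFour_neg_le_quadratic_1280 (hs i hi) (hs1 i hi)).trans ?_
      rw [Finset.sum_add_distrib, Finset.sum_add_distrib, ← Finset.mul_sum, ← Finset.mul_sum,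
        ← Finset.mul_sum]
      linarith
  by_cases hbig : ∀ i ∈ I, s i ≤ 887 / 1000
  · refine (Finset.sum_le_sum fun i hi => gFour_neg_le_linear_620 (hs i hi) (hbig i hi)).trans ?_
    rw [← Finset.mul_sum]
    linarith
  push Not at hbig
  obtain ⟨i, hi, hi1⟩ := hbig
  have hcell {L b r : ℝ} (hL : L ≤ s i) (hb : 1 / 2 ≤ b) (hbL : b ≤ L)
      (hbL' : 3 / 4 ≤ b ^ 2 - b * L + L ^ 2) (hr : 0 ≤ r)
      (hlin : ∀ ⦃t⦄, 3 / 5 ≤ t → t ≤ b → gFour (-t) ≤ r * (2 * t - 6 / 5))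
      (hi2 : gFour (-s i) ≤ 3113 / 500 - r * (11 / 5 - 2 * s i)) :
      ∑ i ∈ I, gFour (-s i) ≤ 3113 / 500 := by
    have hle : ∀ j ∈ I.erase i, s j ≤ b := fun j hj => by
      have hjI := Finset.mem_of_mem_erase hj
      have h := hpair i hi j hjI (Finset.ne_of_mem_erase hj)
      by_contra! hjb
      have h1 := hs1 i hi
      nlinarith [mul_nonneg (sub_nonneg.2 hL) (by linarith : 0 ≤ s i + L - b)]
    have hrest := Finset.sum_le_sum fun j hj =>
      hlin (hs j (Finset.mem_of_mem_erase hj)) (hle j hj)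
    rw [← Finset.mul_sum] at hrest
    have h1 := Finset.add_sum_erase I (fun j => gFour (-s j)) hi
    have h2 := Finset.add_sum_erase I (fun j => 2 * s j - 6 / 5) hi
    simp only [← hPdef] at h2
    have h3 := mul_le_mul_of_nonneg_left hP.le hr
    rw [← h2] at h3
    linarith
  rcases le_total (s i) (917 / 1000) with h1 | h1
  · exact hcell hi1.le (by norm_num) (by norm_num) (by norm_num) (by norm_num)
      (fun t => gFour_neg_le_linear_520) (gFour_neg_le_chord_520 hi1.le h1)
  rcases le_total (s i) (941 / 1000) with h2 | h2
  · exact hcell h1 (by norm_num) (by norm_num) (by norm_num) (by norm_num)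
      (fun t => gFour_neg_le_linear_422) (gFour_neg_le_chord_422 h1 h2)
  rcases le_total (s i) (193 / 200) with h3 | h3
  · exact hcell h2 (by norm_num) (by norm_num) (by norm_num) (by norm_num)
      (fun t => gFour_neg_le_linear_328) (gFour_neg_le_chord_328 h2 h3)
  · exact hcell h3 (by norm_num) (by norm_num) (by norm_num) (by norm_num)
      (fun t => gFour_neg_le_linear_220) (gFour_neg_le_chord_220 h3 (hs1 i hi))

/-- Lemma 11: `ĝ₄ ∈ R(4, π/3)`. -/
theorem gFourHat_nonneg_sum (N : ℕ)
    (x : Fin (N + 1) → EuclideanSpace ℝ (Fin 4))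
    (hx : ∀ i, ‖x i‖ = 1)
    (hsep : ∀ i j : Fin (N + 1), i < j → ⟪x i, x j⟫ ≤ 1 / 2) :
    0 ≤ ∑ i, gFourHat ⟪x 0, x i⟫ := by
  have hinj : ∀ i j : Fin (N + 1), i ≠ j → ⟪x i, x j⟫ ≤ 1 / 2 := fun i j hij => by
    rcases lt_or_gt_of_ne hij with h | h
    · exact hsep i j h
    · rw [real_inner_comm]
      exact hsep j i h
  have hpos : ∀ i, i ≠ 0 → 0 < gFour ⟪x 0, x i⟫ → 3 / 5 ≤ ⟪x i, -x 0⟫ := fun i hi h => by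
    have h1 := hinj 0 i hi.symm
    rw [inner_neg_right, real_inner_comm]
    by_contra! h2
    have h3 := gFour_neg_nonpos (s := -⟪x 0, x i⟫) (by linarith) h2.le
    rw [neg_neg] at h3
    linarith
  let I := {i ∈ Finset.univ.erase (0 : Fin (N + 1)) | 0 < gFour ⟪x 0, x i⟫}
  have hI : ∀ i ∈ I, i ≠ 0 ∧ 0 < gFour ⟪x 0, x i⟫ := fun i hi => by simpa [I] using hi
  have hsum := sum_gFour_neg_le (by simp) I (y := x) (f := -x 0) (by simp [hx])
    (fun i _ => hx i) (fun i _ j _ => hinj i j) fun i hi => hpos i (hI i hi).1 (hI i hi).2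
  simp only [inner_neg_right, neg_neg, real_inner_comm (x 0)] at hsum
  have hzero : gFourHat ⟪x 0, x 0⟫ = 1 := by
    rw [real_inner_self_eq_norm_sq, hx, gFourHat]
    norm_num
  have hterm : ∀ i ∈ Finset.univ.erase (0 : Fin (N + 1)), gFourHat ⟪x 0, x i⟫ =
      if 0 < gFour ⟪x 0, x i⟫ then -(1 / 6.226) * gFour ⟪x 0, x i⟫ else 0 := fun i hi => by
    rw [gFourHat, if_pos (hinj 0 i (Finset.ne_of_mem_erase hi).symm)]
    split_ifs with h
    · exact min_eq_left (by linarith)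
    · exact min_eq_right (by linarith)
  rw [← Finset.add_sum_erase _ _ (Finset.mem_univ 0), hzero, Finset.sum_congr rfl hterm,
    ← Finset.sum_filter, ← Finset.mul_sum]
  linarith
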